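/- Let R be a ring, let P be a class of right R-modules closed under isomorphism, arbitrary direct products and direct summands such that every module in P is a pure submodule of some pure-injective module in P, and let S be the class of left R-modules M whose character module M* belongs to P. Then the following are equivalent: (i) S is a definable subcategory of left R-modules; (ii) S is closed under arbitrary direct products; (iii) S is preenveloping: every left R-module M admits a map ψ : M → A with A ∈ S such that every map M → A' with A' ∈ S factors through ψ. -/

import Mathlib

universe u

open MulOpposite DirectSum

noncomputable section

/-- The additive group `ℚ/ℤ`. -/
abbrev RatCircle : Type := AddCircle (1 : ℚ)

/-- The character group `Hom_ℤ(M, ℚ/ℤ)` of an abelian group `M`. -/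
def Character (M : Type u) [AddCommGroup M] : Type u := M →+ RatCircle

namespace Character

instance instAddCommGroup (M : Type u) [AddCommGroup M] : AddCommGroup (Character M) :=
  inferInstanceAs (AddCommGroup (M →+ RatCircle))

instance instFunLike (M : Type u) [AddCommGroup M] : FunLike (Character M) M RatCircle :=
  inferInstanceAs (FunLike (M →+ RatCircle) M RatCircle)

instance instAddMonoidHomClass (M : Type u) [AddCommGroup M] :
    AddMonoidHomClass (Character M) M RatCircle :=
  inferInstanceAs (AddMonoidHomClass (M →+ RatCircle) M RatCircle)

@[ext] lemma ext {M : Type u} [AddCommGroup M] {f g : Character M}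
    (h : ∀ m, f m = g m) : f = g := DFunLike.ext _ _ h

variable {R : Type u} [Ring R]

/-- If `M` is a left `R`-module then `Character M` is a right `R`-module,
via `(f • r) m = f (r • m)`. -/
instance instSMulRight {M : Type u} [AddCommGroup M] [Module R M] :
    SMul Rᵐᵒᵖ (Character M) where
  smul r f :=
    ((f : M →+ RatCircle).comp (DistribMulAction.toAddMonoidHom M r.unop) : M →+ RatCircle)

lemma smul_right_apply {M : Type u} [AddCommGroup M] [Module R M]
    (r : Rᵐᵒᵖ) (f : Character M) (m : M) : (r • f) m = f (r.unop • m) := rfl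

instance moduleRight {M : Type u} [AddCommGroup M] [Module R M] :
    Module Rᵐᵒᵖ (Character M) where
  one_smul f := ext fun m => by rw [smul_right_apply, unop_one, one_smul]
  mul_smul r s f := ext fun m => by
    rw [smul_right_apply, smul_right_apply, smul_right_apply, unop_mul, mul_smul]
  smul_zero r := ext fun m => rfl
  smul_add r f g := ext fun m => rfl
  add_smul r s f := ext fun m => by
    show f ((r + s).unop • m) = f (r.unop • m) + f (s.unop • m)
    rw [unop_add, add_smul, map_add]
  zero_smul f := ext fun m => by
    show f ((0 : Rᵐᵒᵖ).unop • m) = 0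
    rw [unop_zero, zero_smul, map_zero]

/-- If `M` is a right `R`-module then `Character M` is a left `R`-module,
via `(r • f) m = f (m • r)`. -/
instance instSMulLeft {M : Type u} [AddCommGroup M] [Module Rᵐᵒᵖ M] :
    SMul R (Character M) where
  smul r f :=
    ((f : M →+ RatCircle).comp (DistribMulAction.toAddMonoidHom M (op r)) : M →+ RatCircle)

lemma smul_left_apply {M : Type u} [AddCommGroup M] [Module Rᵐᵒᵖ M]
    (r : R) (f : Character M) (m : M) : (r • f) m = f (op r • m) := rfl

instance moduleLeft {M : Type u} [AddCommGroup M] [Module Rᵐᵒᵖ M] :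
    Module R (Character M) where
  one_smul f := ext fun m => by rw [smul_left_apply, op_one, one_smul]
  mul_smul r s f := ext fun m => by
    rw [smul_left_apply, smul_left_apply, smul_left_apply, op_mul, mul_smul]
  smul_zero r := ext fun m => rfl
  smul_add r f g := ext fun m => rfl
  add_smul r s f := ext fun m => by
    show f (op (r + s) • m) = f (op r • m) + f (op s • m)
    rw [op_add, add_smul, map_add]
  zero_smul f := ext fun m => by
    show f (op (0 : R) • m) = 0
    rw [op_zero, zero_smul, map_zero]

end Character

section Defs

variable (A : Type u) [Ring A]

/-- A pure embedding: an injective linear map such that every finite system of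
linear equations with constants in `L` solvable in `M` is solvable in `L`. -/
def IsPureEmbedding {L M : Type u} [AddCommGroup L] [AddCommGroup M]
    [Module A L] [Module A M] (i : L →ₗ[A] M) : Prop :=
  Function.Injective i ∧
    ∀ (m n : ℕ) (r : Matrix (Fin m) (Fin n) A) (l : Fin m → L),
      (∃ x : Fin n → M, ∀ j, (∑ k, r j k • x k) = i (l j)) →
      ∃ y : Fin n → L, ∀ j, (∑ k, r j k • y k) = l j

/-- A module is pure-injective if every pure embedding out of it splits. -/
def IsPureInjective (N : Type u) [AddCommGroup N] [Module A N] : Prop :=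
  ∀ (M : Type u) [AddCommGroup M] [Module A M] (i : N →ₗ[A] M),
    IsPureEmbedding A i → ∃ π : M →ₗ[A] N, π.comp i = LinearMap.id

/-- `N` is (isomorphic to) a direct summand of `N'`. -/
def IsDirectSummand (N N' : Type u) [AddCommGroup N] [AddCommGroup N']
    [Module A N] [Module A N'] : Prop :=
  ∃ (i : N →ₗ[A] N') (π : N' →ₗ[A] N), π.comp i = LinearMap.id

/-- A module is indecomposable if it is nonzero and is not the internal direct sum
of two nonzero submodules. -/
def IsIndecomposable (N : Type u) [AddCommGroup N] [Module A N] : Prop :=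
  (∃ x : N, x ≠ 0) ∧ ∀ U V : Submodule A N, U ≠ ⊥ → V ≠ ⊥ → ¬ IsCompl U V

/-- An injective module: every linear map from a submodule of a module `B` into `E`
extends to `B`. -/
def IsInjectiveModule (E : Type u) [AddCommGroup E] [Module A E] : Prop :=
  ∀ (B : Type u) [AddCommGroup B] [Module A B] (L : Submodule A B) (g : L →ₗ[A] E),
    ∃ h : B →ₗ[A] E, ∀ x : L, h x = g x

/-- A cogenerator: points of any module are separated by maps into `E`. -/
def IsCogenerator (E : Type u) [AddCommGroup E] [Module A E] : Prop :=
  ∀ (X : Type u) [AddCommGroup X] [Module A X] (x : X), x ≠ 0 →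
    ∃ g : X →ₗ[A] E, g x ≠ 0

/-- A class of modules is closed under (arbitrary) direct products. -/
def ProdClosed (C : ModuleCat.{u} A → Prop) : Prop :=
  ∀ (ι : Type u) (f : ι → ModuleCat.{u} A), (∀ i, C (f i)) →
    C (ModuleCat.of A (∀ i, (f i : Type u)))

/-- A class of modules is closed under modules purely embedding into its members. -/
def PureSubClosed (C : ModuleCat.{u} A → Prop) : Prop :=
  ∀ (N M : ModuleCat.{u} A) (i : N →ₗ[A] M), IsPureEmbedding A i → C M → C N

/-- A class of modules is closed under colimits of directed systems. -/
def DirLimClosed (C : ModuleCat.{u} A → Prop) : Prop :=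
  ∀ (ι : Type u) [Preorder ι] [IsDirected ι (· ≤ ·)] [Nonempty ι] [DecidableEq ι]
    (G : ι → Type u) [∀ i, AddCommGroup (G i)] [∀ i, Module A (G i)]
    (f : ∀ i j, i ≤ j → G i →ₗ[A] G j) [DirectedSystem G (fun i j h => f i j h)],
    (∀ i, C (ModuleCat.of A (G i))) → C (ModuleCat.of A (Module.DirectLimit G f))

/-- A definable subcategory: a class of modules (closed under isomorphism) which is closed
under direct products, colimits of directed systems, and pure submodules. -/
def IsDefinable (C : ModuleCat.{u} A → Prop) : Prop :=
  ProdClosed A C ∧ DirLimClosed A C ∧ PureSubClosed A C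

end Defs


/-- The class of left `R`-modules whose character module lies in `P`. -/
def Sclass {R : Type u} [Ring R] (P : ModuleCat.{u} Rᵐᵒᵖ → Prop) :
    ModuleCat.{u} R → Prop :=
  fun M => P (ModuleCat.of Rᵐᵒᵖ (Character (M : Type u)))

namespace Character

variable {R : Type u} [Ring R]

/-- The map of character modules induced by a linear map of left modules. -/
def map {L M : Type u} [AddCommGroup L] [AddCommGroup M] [Module R L] [Module R M]
    (f : L →ₗ[R] M) : Character M →ₗ[Rᵐᵒᵖ] Character L where
  toFun χ := (χ : M →+ RatCircle).comp f.toAddMonoidHom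
  map_add' _ _ := rfl
  map_smul' r χ := ext fun l => congrArg χ (f.map_smul r.unop l).symm

lemma map_apply {L M : Type u} [AddCommGroup L] [AddCommGroup M] [Module R L] [Module R M]
    (f : L →ₗ[R] M) (χ : Character M) (l : L) : map f χ l = χ (f l) := rfl

lemma add_apply {M : Type u} [AddCommGroup M] (χ χ' : Character M) (m : M) :
    (χ + χ') m = χ m + χ' m := rfl

lemma sub_apply {M : Type u} [AddCommGroup M] (χ χ' : Character M) (m : M) :
    (χ - χ') m = χ m - χ' m := rfl

/-- A system of conditions on a `ℚ/ℤ`-valued homomorphism is satisfiable as soon as each of its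
finite subsystems is. -/
lemma exists_of_finitely_satisfiable {V : Type u} [AddCommGroup V] (C : Set (V × RatCircle))
    (hC : ∀ S : Finset (V × RatCircle), ↑S ⊆ C → ∃ χ : V →+ RatCircle, ∀ p ∈ S, χ p.1 = p.2) :
    ∃ χ : V →+ RatCircle, ∀ p ∈ C, χ p.1 = p.2 := by
  classical
  let Φ : (C →₀ ℤ) →ₗ[ℤ] V := Finsupp.linearCombination ℤ fun p => p.1.1
  let Ψ : (C →₀ ℤ) →ₗ[ℤ] RatCircle := Finsupp.linearCombination ℤ fun p => p.1.2
  have hker : LinearMap.ker Φ ≤ LinearMap.ker Ψ := by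
    intro c hc
    obtain ⟨χ, hχ⟩ := hC (c.support.image Subtype.val) (by
      intro p hp
      obtain ⟨q, -, rfl⟩ := Finset.mem_image.1 (Finset.mem_coe.1 hp)
      exact q.2)
    rw [LinearMap.mem_ker] at hc ⊢
    have h : χ (Φ c) = Ψ c := by
      simp only [Φ, Ψ, Finsupp.linearCombination_apply, Finsupp.sum, map_sum, map_zsmul]
      exact Finset.sum_congr rfl fun p hp => by rw [hχ _ (Finset.mem_image_of_mem _ hp)]
    rw [← h, hc, map_zero]
  obtain ⟨χ, hχ⟩ := CharacterModule.dual_surjective_of_injective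
    ((LinearMap.ker Φ).liftQ Φ le_rfl)
    (LinearMap.ker_eq_bot.1 (Submodule.ker_liftQ_eq_bot _ _ _ le_rfl))
    ((LinearMap.ker Φ).liftQ Ψ hker).toAddMonoidHom
  refine ⟨χ, fun p hp => ?_⟩
  have h := DFunLike.congr_fun hχ (Submodule.Quotient.mk (Finsupp.single ⟨p, hp⟩ 1))
  have h1 : Φ (Finsupp.single ⟨p, hp⟩ 1) = p.1 := by simp [Φ]
  have h2 : Ψ (Finsupp.single ⟨p, hp⟩ 1) = p.2 := by simp [Ψ]
  rw [← h1, ← h2]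
  exact h

end Character

section Purity

variable {R : Type u} [Ring R]

lemma IsPureEmbedding.exists_solution {L M : Type u} [AddCommGroup L] [AddCommGroup M]
    [Module R L] [Module R M] {i : L →ₗ[R] M} (hi : IsPureEmbedding R i)
    (S : Finset ((M →₀ R) × L))
    (hS : ∀ p ∈ S, Finsupp.linearCombination R id p.1 = i p.2) :
    ∃ y : M → L, ∀ p ∈ S, Finsupp.linearCombination R y p.1 = p.2 := by
  classical
  let V : Finset M := S.biUnion fun p => p.1.support
  have hV : ∀ {X : Type u} [AddCommGroup X] [Module R X] (p) (_ : p ∈ S) (y : M → X),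
      ∑ k : Fin V.card, p.1 (V.equivFin.symm k) • y (V.equivFin.symm k) =
        Finsupp.linearCombination R y p.1 := by
    intro X _ _ p hp y
    rw [Finsupp.linearCombination_apply,
      Finsupp.sum_of_support_subset p.1 (s := V)
        (Finset.subset_biUnion_of_mem (fun p : (M →₀ R) × L => p.1.support) hp) _ (by simp),
      ← Finset.sum_coe_sort V, ← V.equivFin.symm.sum_comp]
  obtain ⟨y, hy⟩ := hi.2 S.card V.card
    (fun j k => (S.equivFin.symm j).1.1 (V.equivFin.symm k)) (fun j => (S.equivFin.symm j).1.2)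
    ⟨fun k => V.equivFin.symm k, fun j => by
      rw [← hS _ (S.equivFin.symm j).2]
      exact hV _ (S.equivFin.symm j).2 id⟩
  refine ⟨fun m => if h : m ∈ V then y (V.equivFin ⟨m, h⟩) else 0, fun p hp => ?_⟩
  rw [← hV p hp]
  have h := hy (S.equivFin ⟨p, hp⟩)
  simp only [Equiv.symm_apply_apply] at h
  rw [← h]
  exact Finset.sum_congr rfl fun k _ => by simp

/-- The dual of a pure embedding is a split epimorphism. -/
lemma IsPureEmbedding.exists_section_map {L M : Type u} [AddCommGroup L] [AddCommGroup M]
    [Module R L] [Module R M] {i : L →ₗ[R] M} (hi : IsPureEmbedding R i) :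
    ∃ σ : Character L →ₗ[Rᵐᵒᵖ] Character M, (Character.map i).comp σ = LinearMap.id := by
  classical
  let ev (y : M → L) : FreeAbelianGroup (Character L × M) →+ RatCircle :=
    FreeAbelianGroup.lift fun p => p.1 (y p.2)
  let C : Set (FreeAbelianGroup (Character L × M) × RatCircle) :=
    {c | ∃ p : (M →₀ R) × L, Finsupp.linearCombination R id p.1 = i p.2 ∧
      ∀ y : M → L, Finsupp.linearCombination R y p.1 = p.2 → ev y c.1 = c.2}
  obtain ⟨β, hβ⟩ := Character.exists_of_finitely_satisfiable C (by
    intro S hS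
    choose! p hp hev using fun c (hc : c ∈ S) => hS hc
    obtain ⟨y, hy⟩ := hi.exists_solution (S.image p) (Finset.forall_mem_image.2 hp)
    exact ⟨ev y, fun c hc => hev c hc y (hy _ (Finset.mem_image_of_mem _ hc))⟩)
  let b (f : Character L) (m : M) : RatCircle := β (FreeAbelianGroup.of (f, m))
  have hadd_left (f g : Character L) (m : M) : b (f + g) m = b f m + b g m := by
    have h := hβ (.of (f + g, m) - (.of (f, m) + .of (g, m)), 0)
      ⟨(0, 0), by simp, fun y _ => by simp [ev, Character.add_apply]⟩
    simpa [b, sub_eq_zero] using h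
  have hadd_right (f : Character L) (m n : M) : b f (m + n) = b f m + b f n := by
    have h := hβ (.of (f, m + n) - (.of (f, m) + .of (f, n)), 0)
      ⟨(.single (m + n) 1 - (.single m 1 + .single n 1), 0), by simp, fun y hy => by
        simp only [map_sub, map_add, Finsupp.linearCombination_single, one_smul] at hy
        simp only [ev, map_sub, map_add, FreeAbelianGroup.lift_apply_of]
        rw [← map_add, ← map_sub, hy, map_zero]⟩
    simpa [b, sub_eq_zero] using h
  have hsmul (r : Rᵐᵒᵖ) (f : Character L) (m : M) : b (r • f) m = b f (r.unop • m) := by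
    have h := hβ (.of (r • f, m) - .of (f, r.unop • m), 0)
      ⟨(.single m r.unop - .single (r.unop • m) 1, 0), by simp, fun y hy => by
        simp only [map_sub, Finsupp.linearCombination_single, one_smul] at hy
        simp only [ev, map_sub, FreeAbelianGroup.lift_apply_of, Character.smul_right_apply]
        rw [← map_sub, hy, map_zero]⟩
    simpa [b, sub_eq_zero] using h
  have hi_apply (f : Character L) (l : L) : b f (i l) = f l :=
    hβ (.of (f, i l), f l)
      ⟨(.single (i l) 1, l), by simp, fun y hy => by
        simp only [Finsupp.linearCombination_single, one_smul] at hy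
        simp [ev, hy]⟩
  refine ⟨{ toFun := fun f => AddMonoidHom.mk' (b f) (hadd_right f)
            map_add' := fun f g => Character.ext (hadd_left f g)
            map_smul' := fun r f => Character.ext (hsmul r f) }, ?_⟩
  exact LinearMap.ext fun f => Character.ext fun l => hi_apply f l

/-- If `p` is a surjection with pure kernel, then the dual of its target is a summand of the dual
of its source. -/
lemma isDirectSummand_character_of_surjective {B M : Type u} [AddCommGroup B] [AddCommGroup M]
    [Module R B] [Module R M] (p : B →ₗ[R] M) (hp : Function.Surjective p)
    (hker : IsPureEmbedding R (LinearMap.ker p).subtype) :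
    IsDirectSummand Rᵐᵒᵖ (Character M) (Character B) := by
  obtain ⟨σ, hσ⟩ := hker.exists_section_map
  let τ : Character B →ₗ[Rᵐᵒᵖ] Character B :=
    LinearMap.id - σ.comp (Character.map (LinearMap.ker p).subtype)
  have hτ (χ : Character B) (x : B) (hx : p x = 0) : τ χ x = 0 := by
    have h := DFunLike.congr_fun
      (LinearMap.congr_fun hσ (Character.map (LinearMap.ker p).subtype χ)) ⟨x, hx⟩
    exact sub_eq_zero.2 h.symm
  let s := Function.surjInv hp
  have hs (m : M) : p (s m) = m := Function.surjInv_eq hp m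
  have hτ' (χ : Character B) (x y : B) (h : p x = p y) : τ χ x = τ χ y := by
    rw [← sub_eq_zero, ← map_sub]
    exact hτ χ _ (by rw [map_sub, h, sub_self])
  refine ⟨Character.map p,
    { toFun := fun χ => AddMonoidHom.mk' (fun m => τ χ (s m)) fun m n => by
        rw [← map_add]
        exact hτ' χ _ _ (by simp [hs])
      map_add' := fun χ χ' => Character.ext fun m => by
        change τ (χ + χ') (s m) = τ χ (s m) + τ χ' (s m)
        rw [map_add, Character.add_apply]
      map_smul' := fun r χ => Character.ext fun m => by
        change τ (r • χ) (s m) = τ χ (s (r.unop • m))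
        rw [map_smul, Character.smul_right_apply]
        exact hτ' χ _ _ (by simp [hs]) }, ?_⟩
  refine LinearMap.ext fun χ => Character.ext fun m => ?_
  change Character.map p χ (s m) -
    σ (Character.map (LinearMap.ker p).subtype (Character.map p χ)) (s m) = χ m
  have h0 : Character.map (LinearMap.ker p).subtype (Character.map p χ) = 0 :=
    Character.ext fun x => (congrArg χ x.2).trans (map_zero χ)
  rw [h0, map_zero, Character.map_apply, hs]
  exact sub_zero _

end Purity

section DirectLimit

variable {R : Type u} [Ring R] {ι : Type u} [DecidableEq ι]
  (G : ι → Type u) [∀ i, AddCommGroup (G i)] [∀ i, Module R (G i)]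

namespace Character

/-- The character of a direct sum with prescribed restrictions to the summands. -/
def ofDirectSum (χ : ∀ i, Character (G i)) : Character (⨁ i, G i) :=
  DirectSum.toAddMonoid fun i => (χ i : G i →+ RatCircle)

lemma ofDirectSum_lof (χ : ∀ i, Character (G i)) (i : ι) (x : G i) :
    ofDirectSum G χ (DirectSum.lof R ι G i x) = χ i x :=
  DirectSum.toAddMonoid_of _ i x

variable (R) in
lemma directSum_ext {χ χ' : Character (⨁ i, G i)}
    (h : ∀ i x, χ (DirectSum.lof R ι G i x) = χ' (DirectSum.lof R ι G i x)) : χ = χ' :=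
  DirectSum.addHom_ext (f := (χ : (⨁ i, G i) →+ RatCircle)) h

end Character

variable (R) in
/-- The dual of a direct sum is a summand of the product of the duals. -/
lemma isDirectSummand_character_directSum :
    IsDirectSummand Rᵐᵒᵖ (Character (⨁ i, G i)) (∀ i, Character (G i)) := by
  refine ⟨LinearMap.pi fun i => Character.map (DirectSum.lof R ι G i),
    { toFun := Character.ofDirectSum G
      map_add' := fun χ χ' => Character.directSum_ext R G fun i x => ?_
      map_smul' := fun r χ => Character.directSum_ext R G fun i x => ?_ }, ?_⟩
  · simp only [Character.add_apply, Character.ofDirectSum_lof, Pi.add_apply]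
  · simp only [RingHom.id_apply, Character.smul_right_apply, ← map_smul,
      Character.ofDirectSum_lof, Pi.smul_apply]
  · exact LinearMap.ext fun χ => Character.directSum_ext R G fun i x =>
      Character.ofDirectSum_lof G _ i x

variable [Preorder ι] (f : ∀ i j, i ≤ j → G i →ₗ[R] G j)

/-- The canonical map from a direct sum to a direct limit. -/
def directSumToDirectLimit : (⨁ i, G i) →ₗ[R] Module.DirectLimit G f :=
  DirectSum.toModule R ι _ (Module.DirectLimit.of R ι G f)

lemma directSumToDirectLimit_lof (i : ι) (x : G i) :
    directSumToDirectLimit G f (DirectSum.lof R ι G i x) = Module.DirectLimit.of R ι G f i x :=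
  DirectSum.toModule_lof R i x

open Classical in
/-- The map from a direct sum to its `j`-th term given by the transition maps, and by zero on the
terms whose index is not below `j`. -/
def directSumToStage (j : ι) : (⨁ i, G i) →ₗ[R] G j :=
  DirectSum.toModule R ι _ fun i => if h : i ≤ j then f i j h else 0

lemma directSumToStage_lof {i j : ι} (h : i ≤ j) (x : G i) :
    directSumToStage G f j (DirectSum.lof R ι G i x) = f i j h x := by
  rw [directSumToStage, DirectSum.toModule_lof, dif_pos h]

/-- Far enough in the direct system, an element of the direct sum agrees in the limit with its
image in a single term. -/
lemma eventually_of_directSumToStage (x : ⨁ i, G i) :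
    ∀ᶠ j in Filter.atTop, Module.DirectLimit.of R ι G f j (directSumToStage G f j x) =
      directSumToDirectLimit G f x := by
  induction x using DirectSum.induction_on with
  | zero => exact .of_forall fun j => by simp only [map_zero]
  | of i x =>
    filter_upwards [Filter.eventually_ge_atTop i] with j hj
    rw [← DirectSum.lof_eq_of R, directSumToStage_lof G f hj, directSumToDirectLimit_lof,
      Module.DirectLimit.of_f]
  | add x y hx hy =>
    filter_upwards [hx, hy] with j hxj hyj
    simp only [map_add, hxj, hyj]

lemma eventually_map_directSumToStage
    [DirectedSystem G (fun i j h => f i j h)] (x : ⨁ i, G i) :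
    ∀ᶠ i in Filter.atTop, ∀ j (h : i ≤ j),
      f i j h (directSumToStage G f i x) = directSumToStage G f j x := by
  induction x using DirectSum.induction_on with
  | zero => exact .of_forall fun i j h => by simp only [map_zero]
  | of i x =>
    filter_upwards [Filter.eventually_ge_atTop i] with j hj k hk
    rw [← DirectSum.lof_eq_of R, directSumToStage_lof G f hj,
      directSumToStage_lof G f (hj.trans hk)]
    exact DirectedSystem.map_map' f hj hk x
  | add x y hx hy =>
    filter_upwards [hx, hy] with i hxi hyi j h
    simp only [map_add, hxi j h, hyi j h]

variable [IsDirected ι (· ≤ ·)] [Nonempty ι]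

lemma directSumToDirectLimit_surjective : Function.Surjective (directSumToDirectLimit G f) := by
  intro z
  obtain ⟨i, x, rfl⟩ := Module.DirectLimit.exists_of z
  exact ⟨_, directSumToDirectLimit_lof G f i x⟩

variable [DirectedSystem G (fun i j h => f i j h)]

lemma eventually_directSumToStage_eq_zero (x : ⨁ i, G i) (hx : directSumToDirectLimit G f x = 0) :
    ∀ᶠ j in Filter.atTop, directSumToStage G f j x = 0 := by
  obtain ⟨i, hi, hij⟩ :=
    ((eventually_of_directSumToStage G f x).and (eventually_map_directSumToStage G f x)).exists
  obtain ⟨k, hik, hk⟩ := Module.DirectLimit.of.zero_exact (hi.trans hx)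
  filter_upwards [Filter.eventually_ge_atTop k] with j hj
  rw [← hij j (hik.trans hj), ← DirectedSystem.map_map' f hik hj]
  exact (congrArg (f k j hj) hk).trans (map_zero _)

/-- The kernel of the canonical map from a direct sum to a direct limit is pure. -/
lemma isPureEmbedding_ker_directSumToDirectLimit :
    IsPureEmbedding R (LinearMap.ker (directSumToDirectLimit G f)).subtype := by
  refine ⟨Subtype.val_injective, fun m n r l => ?_⟩
  rintro ⟨x, hx⟩
  obtain ⟨j, hj, hl⟩ := ((Filter.eventually_all.2 fun k =>
    eventually_of_directSumToStage G f (x k)).and (Filter.eventually_all.2 fun k =>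
      eventually_directSumToStage_eq_zero G f (l k) (l k).2)).exists
  refine ⟨fun k => ⟨x k - DirectSum.lof R ι G j (directSumToStage G f j (x k)), ?_⟩, fun k => ?_⟩
  · rw [LinearMap.mem_ker, map_sub, directSumToDirectLimit_lof, hj, sub_self]
  · have h := congrArg (fun z => z - DirectSum.lof R ι G j (directSumToStage G f j z)) (hx k)
    apply Subtype.ext
    simpa [hl, smul_sub, map_sum, Finset.sum_sub_distrib] using h

end DirectLimit

section PureHull

variable {R : Type u} [Ring R]

variable (R) in
/-- Formal names for the elements of the pure submodule generated by the image of `M` in a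
module. -/
inductive PureTerm (M : Type u) : Type u
  | of (m : M)
  | zero
  | add (s t : PureTerm M)
  | smul (r : R) (t : PureTerm M)
  | solution (m n : ℕ) (r : Matrix (Fin m) (Fin n) R) (t : Fin m → PureTerm M) (k : Fin n)

namespace PureTerm

variable {M A : Type u} [AddCommGroup A] [Module R A]

open Classical in
/-- The value of a formal name; unsolvable systems are given the value zero. -/
def eval (g : M → A) : PureTerm R M → A
  | of m => g m
  | zero => 0
  | add s t => s.eval g + t.eval g
  | smul r t => r • t.eval g
  | solution _ n r t k =>
    if h : ∃ x : Fin n → A, ∀ j, ∑ k, r j k • x k = (t j).eval g then h.choose k else 0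

lemma exists_eval_eq_linearCombination (g : M → A) (c : PureTerm R M →₀ R) :
    ∃ t : PureTerm R M, t.eval g = Finsupp.linearCombination R (eval g) c := by
  induction c using Finsupp.induction_linear with
  | zero => exact ⟨zero, by simp [eval]⟩
  | add c d hc hd =>
    obtain ⟨s, hs⟩ := hc
    obtain ⟨t, ht⟩ := hd
    exact ⟨add s t, by rw [eval, hs, ht, map_add]⟩
  | single t r => exact ⟨smul r t, by simp [eval]⟩

/-- The quotient of the free module on formal names by the relations that hold in `A`. -/
abbrev evalKer (g : M → A) : Submodule R (PureTerm R M →₀ R) :=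
  LinearMap.ker (Finsupp.linearCombination R (eval g))

/-- The embedding of the pure submodule generated by the image of `M`. -/
def evalQuotient (g : M → A) : ((PureTerm R M →₀ R) ⧸ evalKer (R := R) g) →ₗ[R] A :=
  (evalKer (R := R) g).liftQ (Finsupp.linearCombination R (eval g)) le_rfl

lemma evalQuotient_mk_single (g : M → A) (t : PureTerm R M) :
    evalQuotient g (Submodule.Quotient.mk (Finsupp.single t 1)) = t.eval g := by
  simp [evalQuotient]

lemma evalQuotient_injective (g : M → A) : Function.Injective (evalQuotient (R := R) g) :=
  LinearMap.ker_eq_bot.1 (Submodule.ker_liftQ_eq_bot _ _ _ le_rfl)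

lemma isPureEmbedding_evalQuotient (g : M → A) : IsPureEmbedding R (evalQuotient (R := R) g) := by
  refine ⟨evalQuotient_injective g, fun m n r l hl => ?_⟩
  have hsurj : ∀ j, ∃ t : PureTerm R M, t.eval g = evalQuotient g (l j) := fun j => by
    obtain ⟨c, hc⟩ := Submodule.Quotient.mk_surjective _ (l j)
    rw [← hc]
    exact exists_eval_eq_linearCombination g c
  choose t ht using hsurj
  simp only [← ht] at hl
  refine ⟨fun k => Submodule.Quotient.mk (Finsupp.single (solution m n r t k) 1), fun j => ?_⟩
  apply evalQuotient_injective g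
  simp only [map_sum, map_smul, evalQuotient_mk_single, ← ht]
  simp only [eval, dif_pos hl]
  exact hl.choose_spec j

/-- The factorization of a linear map through the pure submodule generated by its image. -/
lemma exists_evalQuotient_comp_eq [AddCommGroup M] [Module R M] (g : M →ₗ[R] A) :
    ∃ φ : M →ₗ[R] (PureTerm R M →₀ R) ⧸ evalKer (R := R) g, (evalQuotient g).comp φ = g := by
  have h (m : M) : evalQuotient (R := R) g
      (Submodule.Quotient.mk (Finsupp.single (PureTerm.of m) 1)) = g m :=
    evalQuotient_mk_single _ _
  exact ⟨{ toFun := fun m => Submodule.Quotient.mk (Finsupp.single (PureTerm.of m) 1)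
           map_add' := fun m n => evalQuotient_injective (R := R) g (by
            rw [map_add]; simp only [h, map_add])
           map_smul' := fun r m => evalQuotient_injective (R := R) g (by
            rw [map_smul]; simp only [h, map_smul, RingHom.id_apply]) }, LinearMap.ext h⟩

end PureTerm

end PureHull

section Preenveloping

variable {R : Type u} [Ring R]

/-- Every module maps to a member of the class so that all maps to members factor through it. -/
def IsPreenveloping (C : ModuleCat.{u} R → Prop) : Prop :=
  ∀ M : ModuleCat.{u} R, ∃ A : ModuleCat.{u} R, C A ∧ ∃ ψ : (M : Type u) →ₗ[R] (A : Type u),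
    ∀ A' : ModuleCat.{u} R, C A' → ∀ g : (M : Type u) →ₗ[R] (A' : Type u),
      ∃ h : (A : Type u) →ₗ[R] (A' : Type u), h.comp ψ = g

/-- A class closed under products and pure submodules is preenveloping. -/
lemma isPreenveloping_of_prodClosed_of_pureSubClosed {C : ModuleCat.{u} R → Prop}
    (hprod : ProdClosed R C) (hpure : PureSubClosed R C) : IsPreenveloping C := by
  intro M
  let I := Σ K : {K : Submodule R (PureTerm R M →₀ R) // C (.of R ((PureTerm R M →₀ R) ⧸ K))},
    M →ₗ[R] (PureTerm R M →₀ R) ⧸ K.1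
  let Q (i : I) : ModuleCat.{u} R := .of R ((PureTerm R M →₀ R) ⧸ i.1.1)
  refine ⟨_, hprod I Q fun i => i.1.2, LinearMap.pi (φ := fun i => Q i) fun i => i.2,
    fun A hA g => ?_⟩
  obtain ⟨φ, hφ⟩ := PureTerm.exists_evalQuotient_comp_eq g
  let i : I := ⟨⟨PureTerm.evalKer g,
    hpure (.of R _) A (PureTerm.evalQuotient g) (PureTerm.isPureEmbedding_evalQuotient g) hA⟩, φ⟩
  exact ⟨(PureTerm.evalQuotient g).comp (LinearMap.proj (φ := fun i => Q i) i), hφ⟩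

/-- A preenveloping class closed under summands is closed under products. -/
lemma prodClosed_of_isPreenveloping {C : ModuleCat.{u} R → Prop} (hC : IsPreenveloping C)
    (hsummand : ∀ N M : ModuleCat.{u} R, C M → IsDirectSummand R N M → C N) :
    ProdClosed R C := by
  intro ι f hf
  obtain ⟨A, hA, ψ, hψ⟩ := hC (.of R (∀ i, f i))
  choose h hh using fun i => hψ (f i) (hf i) (LinearMap.proj i)
  exact hsummand _ A hA ⟨ψ, LinearMap.pi h, LinearMap.ext fun x => funext fun i =>
    LinearMap.congr_fun (hh i) x⟩

lemma IsDirectSummand.trans {A : Type u} [Ring A] {L M N : Type u} [AddCommGroup L]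
    [AddCommGroup M] [AddCommGroup N] [Module A L] [Module A M] [Module A N]
    (h : IsDirectSummand A L M) (h' : IsDirectSummand A M N) : IsDirectSummand A L N := by
  obtain ⟨i, π, hπ⟩ := h
  obtain ⟨i', π', hπ'⟩ := h'
  refine ⟨i'.comp i, π.comp π', LinearMap.ext fun x => ?_⟩
  exact (congrArg π (LinearMap.congr_fun hπ' (i x))).trans (LinearMap.congr_fun hπ x)

lemma IsDirectSummand.character {N M : Type u} [AddCommGroup N] [AddCommGroup M] [Module R N]
    [Module R M] (h : IsDirectSummand R N M) :
    IsDirectSummand Rᵐᵒᵖ (Character N) (Character M) := by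
  obtain ⟨i, π, hπ⟩ := h
  exact ⟨Character.map π, Character.map i, LinearMap.ext fun χ => Character.ext fun x =>
    congrArg χ (LinearMap.congr_fun hπ x)⟩

/-- The dual of a pure submodule is a summand. -/
lemma IsPureEmbedding.isDirectSummand_character {L M : Type u} [AddCommGroup L] [AddCommGroup M]
    [Module R L] [Module R M] {i : L →ₗ[R] M} (hi : IsPureEmbedding R i) :
    IsDirectSummand Rᵐᵒᵖ (Character L) (Character M) :=
  let ⟨σ, hσ⟩ := hi.exists_section_map
  ⟨σ, Character.map i, hσ⟩

end Preenveloping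

theorem almost_dual_pair_S_definable_iff_products_iff_preenveloping
    {R : Type u} [Ring R] (P : ModuleCat.{u} Rᵐᵒᵖ → Prop)
    (hiso : ∀ (N N' : ModuleCat.{u} Rᵐᵒᵖ), P N → ((N : Type u) ≃ₗ[Rᵐᵒᵖ] (N' : Type u)) → P N')
    (hprod : ProdClosed Rᵐᵒᵖ P)
    (hsummand : ∀ (N N' : ModuleCat.{u} Rᵐᵒᵖ), P N' →
      IsDirectSummand Rᵐᵒᵖ (N : Type u) (N' : Type u) → P N)
    (hhull : ∀ N : ModuleCat.{u} Rᵐᵒᵖ, P N → ∃ N' : ModuleCat.{u} Rᵐᵒᵖ,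
      P N' ∧ IsPureInjective Rᵐᵒᵖ (N' : Type u) ∧
      ∃ i : (N : Type u) →ₗ[Rᵐᵒᵖ] (N' : Type u), IsPureEmbedding Rᵐᵒᵖ i) :
    List.TFAE
      [ IsDefinable R (Sclass P),
        ProdClosed R (Sclass P),
        ∀ (M : ModuleCat.{u} R), ∃ (A : ModuleCat.{u} R), Sclass P A ∧
          ∃ ψ : (M : Type u) →ₗ[R] (A : Type u),
            ∀ (A' : ModuleCat.{u} R), Sclass P A' →
              ∀ g : (M : Type u) →ₗ[R] (A' : Type u),
                ∃ h : (A : Type u) →ₗ[R] (A' : Type u), h.comp ψ = g ] := by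
  have hpure : PureSubClosed R (Sclass P) := fun N M i hi hM =>
    hsummand _ _ hM hi.isDirectSummand_character
  have hlim : DirLimClosed R (Sclass P) := by
    intro ι _ _ _ _ G _ _ f _ hG
    exact hsummand _ (.of Rᵐᵒᵖ (∀ i, Character (G i)))
      (hprod ι (fun i => .of Rᵐᵒᵖ (Character (G i))) hG)
      ((isDirectSummand_character_of_surjective _ (directSumToDirectLimit_surjective G f)
        (isPureEmbedding_ker_directSumToDirectLimit G f)).trans
          (isDirectSummand_character_directSum R G))
  tfae_have 1 → 2 := fun h => h.1
  tfae_have 2 → 1 := fun h => ⟨h, hlim, hpure⟩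
  tfae_have 2 → 3 := fun h => isPreenveloping_of_prodClosed_of_pureSubClosed h hpure
  tfae_have 3 → 2 := fun h => prodClosed_of_isPreenveloping h fun _ _ hM hN =>
    hsummand _ _ hM hN.character
  tfae_finish

end
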